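/- Let X be a Polish space partitioned into countably many pairwise disjoint Borel sets (I_α)_{α∈A}, let λ_α be a probability measure concentrated on I_α, μ := ∑_α m_α λ_α with ∑_α m_α = 1, label map ℓ, cost C(x,y) := Ĉ(ℓ(x),ℓ(y)) with Ĉ : A × A → [0,∞), and μ̂ := ℓ_#μ. For P̂ with both marginals μ̂, define the lift L(P̂) := ∑_{α,β} P̂(α,β)·(λ_α⊗λ_β), and define Ĵ_ε(P̂) := ∑ Ĉ dP̂ + ε·KL(P̂‖μ̂⊗μ̂), J_ε(P) := ∫ C dP + ε·KL(P‖μ⊗μ). Assume Ĵ_ε has a unique minimiser P̂_ε. Then for every ε > 0: (i) inf_{P∈Π(μ,μ)} J_ε(P) = inf_{P̂} Ĵ_ε(P̂), the minimisers of J_ε are exactly the lifts of minimisers of Ĵ_ε, and the unique minimiser of J_ε is P_ε = L(P̂_ε); (ii) P_ε restricted to I_α × I_β equals P̂_ε(α,β)·(λ_α⊗λ_β), so P_ε(I_α × I_β) = P̂_ε(α,β), and for any Â ⊆ A × A and A' := ⋃_{(α,β)∈Â} I_α × I_β one has P_ε(A') = P̂_ε(Â); (iii) for any P̂, Q̂ with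 marginals μ̂, ‖L(P̂) − L(Q̂)‖_TV = ‖P̂ − Q̂‖_TV. -/

import Mathlib

open MeasureTheory Filter Set Topology
open scoped ENNReal NNReal Classical

noncomputable section

/-- Relative entropy (Kullback–Leibler divergence). -/
def KL {Ω : Type*} [MeasurableSpace Ω] (P Q : Measure Ω) : EReal :=
  if P ≪ Q ∧ Integrable (fun x => Real.log ((P.rnDeriv Q x).toReal)) P
  then ((∫ x, Real.log ((P.rnDeriv Q x).toReal) ∂P : ℝ) : EReal) else ⊤

/-- Couplings with prescribed marginals. -/
def couplings {X Y : Type*} [MeasurableSpace X] [MeasurableSpace Y]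
    (μ : Measure X) (ν : Measure Y) : Set (Measure (X × Y)) :=
  {P | IsProbabilityMeasure P ∧ P.map Prod.fst = μ ∧ P.map Prod.snd = ν}

/-- Entropic functional. -/
def Jfun {Z : Type*} [MeasurableSpace Z] (C : Z → ℝ) (R : Measure Z) (ε : ℝ)
    (P : Measure Z) : EReal :=
  ((∫⁻ z, ENNReal.ofReal (C z) ∂P : ℝ≥0∞) : EReal) + (ε : EReal) * KL P R

/-- Total variation distance `‖P − Q‖_TV = sup_A |P(A) − Q(A)|`. -/
def TVdist {Ω : Type*} [MeasurableSpace Ω] (P Q : Measure Ω) : ℝ≥0∞ :=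
  ⨆ (A : Set Ω) (_ : MeasurableSet A), max (P A - Q A) (Q A - P A)

/-- The lift `L(P̂) := ∑_{α,β} P̂(α,β) (λ_α ⊗ λ_β)`. -/
def liftPlan {X : Type*} [MeasurableSpace X] {A : Type*} [Countable A] [MeasurableSpace A]
    (lam : A → Measure X) (Phat : Measure (A × A)) : Measure (X × X) :=
  Measure.sum (fun q : A × A => Phat {q} • ((lam q.1).prod (lam q.2)))

open InformationTheory ProbabilityTheory

lemma KL_eq_klDiv {Ω : Type*} [MeasurableSpace Ω] (P Q : Measure Ω)
    [IsProbabilityMeasure P] [IsProbabilityMeasure Q] :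
    KL P Q = (klDiv P Q : EReal) := by
  unfold KL
  split_ifs with h
  · have h' : klDiv P Q ≠ ∞ := klDiv_ne_top h.1 h.2
    rw [← EReal.coe_ennreal_toReal h', toReal_klDiv_of_measure_eq h.1 (by simp)]
    rfl
  · have h' : klDiv P Q = ∞ := by
      by_contra hne
      exact h (klDiv_ne_top_iff.1 hne)
    simp [h']

/-- The entropic functional between probability measures, as an extended nonnegative number. -/
def entropicCost {Z : Type*} [MeasurableSpace Z] (C : Z → ℝ) (R : Measure Z) (ε : ℝ)
    (P : Measure Z) : ℝ≥0∞ :=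
  (∫⁻ z, ENNReal.ofReal (C z) ∂P) + ENNReal.ofReal ε * klDiv P R

lemma Jfun_eq_entropicCost {Z : Type*} [MeasurableSpace Z] (C : Z → ℝ) (R : Measure Z)
    [IsProbabilityMeasure R] {ε : ℝ} (hε : 0 < ε) (P : Measure Z) [IsProbabilityMeasure P] :
    Jfun C R ε P = (entropicCost C R ε P : EReal) := by
  rw [Jfun, entropicCost, KL_eq_klDiv, EReal.coe_ennreal_add, EReal.coe_ennreal_mul,
    EReal.coe_ennreal_ofReal, max_eq_left hε.le]

namespace ProbabilityTheory.Kernel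

variable {Z B : Type*} [MeasurableSpace Z] [MeasurableSpace B]
  {κ : Kernel B Z} [IsMarkovKernel κ] {π : Z → B}

lemma map_graph_comp_measure (hπ : Measurable π) (hκ : ∀ b, ∀ᵐ z ∂κ b, π z = b)
    (ρ : Measure B) [IsFiniteMeasure ρ] :
    (κ ∘ₘ ρ).map (fun z => (π z, z)) = ρ ⊗ₘ κ := by
  have hg : Measurable fun z => (π z, z) := hπ.prodMk measurable_id'
  ext s hs
  rw [Measure.map_apply hg hs, Measure.bind_apply (hg hs) κ.aemeasurable,
    Measure.compProd_apply hs]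
  refine lintegral_congr fun b => measure_congr ?_
  filter_upwards [hκ b] with z hz
  change ((π z, z) ∈ s) = ((b, z) ∈ s)
  rw [hz]

lemma comp_measure_inter_preimage (hπ : Measurable π) (hκ : ∀ b, ∀ᵐ z ∂κ b, π z = b)
    (ρ : Measure B) [IsFiniteMeasure ρ] {S : Set Z} (hS : MeasurableSet S) {T : Set B}
    (hT : MeasurableSet T) :
    (κ ∘ₘ ρ) (S ∩ π ⁻¹' T) = ∫⁻ b in T, κ b S ∂ρ := by
  rw [← Measure.compProd_apply_prod hT hS, ← map_graph_comp_measure hπ hκ ρ,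
    Measure.map_apply (hπ.prodMk measurable_id') (hT.prod hS)]
  congr 1
  ext z
  simp [and_comm]

lemma map_comp_measure_eq_self (hπ : Measurable π) (hκ : ∀ b, ∀ᵐ z ∂κ b, π z = b)
    (ρ : Measure B) [IsFiniteMeasure ρ] : (κ ∘ₘ ρ).map π = ρ := by
  ext T hT
  have h := comp_measure_inter_preimage hπ hκ ρ MeasurableSet.univ hT
  simpa [Measure.map_apply hπ hT] using h

lemma klDiv_map_graph (hπ : Measurable π) (P Q : Measure Z) [IsFiniteMeasure P]
    [IsFiniteMeasure Q] :
    klDiv (P.map fun z => (π z, z)) (Q.map fun z => (π z, z)) = klDiv P Q := by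
  have hg : Measurable fun z => (π z, z) := hπ.prodMk measurable_id'
  refine le_antisymm (klDiv_map_le P Q hg) ?_
  have h := klDiv_map_le (P.map fun z => (π z, z)) (Q.map fun z => (π z, z)) measurable_snd
  rw [Measure.map_map measurable_snd hg, Measure.map_map measurable_snd hg] at h
  simpa [Function.comp_def] using h

/-- Chain rule for the relative entropy with respect to a mixture of measures carried by the
fibres of a map. -/
lemma klDiv_comp_measure_eq_add [StandardBorelSpace Z] (hπ : Measurable π)
    (hκ : ∀ b, ∀ᵐ z ∂κ b, π z = b) (P : Measure Z) [IsProbabilityMeasure P]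
    (ρ : Measure B) [IsFiniteMeasure ρ] :
    klDiv P (κ ∘ₘ ρ) = klDiv (P.map π) ρ + klDiv P (κ ∘ₘ P.map π) := by
  have hg : Measurable fun z => (π z, z) := hπ.prodMk measurable_id'
  have : Nonempty Z := nonempty_of_isProbabilityMeasure P
  have : IsProbabilityMeasure (P.map π) := Measure.isProbabilityMeasure_map hπ.aemeasurable
  have : IsProbabilityMeasure (P.map fun z => (π z, z)) :=
    Measure.isProbabilityMeasure_map hg.aemeasurable
  have hfst : (P.map fun z => (π z, z)).fst = P.map π := by
    rw [Measure.fst, Measure.map_map measurable_fst hg]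
    rfl
  have hdis : P.map (fun z => (π z, z)) =
      P.map π ⊗ₘ (P.map fun z => (π z, z)).condKernel := by
    conv_rhs => rw [← hfst]
    exact (Measure.disintegrate _ _).symm
  rw [← klDiv_map_graph hπ P (κ ∘ₘ ρ), ← klDiv_map_graph hπ P (κ ∘ₘ P.map π),
    map_graph_comp_measure hπ hκ, map_graph_comp_measure hπ hκ, hdis]
  exact klDiv_compProd_eq_add _ _ _ _

lemma entropicCost_comp_measure_eq_add [StandardBorelSpace Z] [DiscreteMeasurableSpace B]
    (hπ : Measurable π)
    (hκ : ∀ b, ∀ᵐ z ∂κ b, π z = b) (C : B → ℝ) (ε : ℝ) (P : Measure Z) [IsProbabilityMeasure P]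
    (ρ : Measure B) [IsFiniteMeasure ρ] :
    entropicCost (C ∘ π) (κ ∘ₘ ρ) ε P =
      entropicCost C ρ ε (P.map π) + ENNReal.ofReal ε * klDiv P (κ ∘ₘ P.map π) := by
  rw [entropicCost, entropicCost, klDiv_comp_measure_eq_add hπ hκ, mul_add, add_assoc,
    MeasureTheory.lintegral_map (f := fun b => ENNReal.ofReal (C b)) .of_discrete hπ]
  rfl

end ProbabilityTheory.Kernel

section TotalVariation

variable {Z B : Type*} [MeasurableSpace Z] [MeasurableSpace B] [Countable B]
  [MeasurableSingletonClass B]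

lemma lintegral_tsub_le_of_le_one {f : B → ℝ≥0∞} (hf : ∀ b, f b ≤ 1) (μ ν : Measure B)
    [IsFiniteMeasure ν] :
    ∃ T : Set B, (∫⁻ b, f b ∂μ) - (∫⁻ b, f b ∂ν) ≤ μ T - ν T := by
  set T : Set B := {b | ν {b} ≤ μ {b}}
  refine ⟨T, ?_⟩
  have hTm : MeasurableSet T := T.to_countable.measurableSet
  have key : (∫⁻ b, f b ∂μ) + ν T ≤ (∫⁻ b, f b ∂ν) + μ T := by
    rw [← lintegral_indicator_one hTm, ← lintegral_indicator_one hTm]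
    simp only [lintegral_countable']
    rw [← ENNReal.tsum_add, ← ENNReal.tsum_add]
    refine ENNReal.tsum_le_tsum fun b => ?_
    by_cases hb : b ∈ T
    · obtain ⟨d, hd⟩ := exists_add_of_le (show ν {b} ≤ μ {b} from hb)
      simp only [hb, indicator_of_mem, Pi.one_apply, one_mul, hd, mul_add]
      have : f b * d ≤ d := mul_le_of_le_one_left' (hf b)
      calc f b * ν {b} + f b * d + ν {b} ≤ f b * ν {b} + d + ν {b} := by gcongr
        _ = f b * ν {b} + (ν {b} + d) := by ring
    · have : μ {b} ≤ ν {b} := (not_le.1 hb).le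
      simp only [hb, not_false_eq_true, indicator_of_notMem, zero_mul, add_zero]
      gcongr
  rw [tsub_le_iff_left]
  exact (ENNReal.le_sub_of_add_le_right (measure_ne_top ν T) key).trans add_tsub_le_assoc

lemma TVdist_comp_measure {κ : Kernel B Z} [IsMarkovKernel κ] {π : Z → B} (hπ : Measurable π)
    (hκ : ∀ b, ∀ᵐ z ∂κ b, π z = b) (Q R : Measure B) [IsFiniteMeasure Q] [IsFiniteMeasure R] :
    TVdist (κ ∘ₘ Q) (κ ∘ₘ R) = TVdist Q R := by
  refine le_antisymm (iSup₂_le fun S hS => ?_) (iSup₂_le fun T hT => ?_)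
  · rw [Measure.bind_apply hS κ.aemeasurable, Measure.bind_apply hS κ.aemeasurable]
    refine max_le ?_ ?_
    · obtain ⟨T, hT⟩ := lintegral_tsub_le_of_le_one (fun b => prob_le_one (μ := κ b) (s := S)) Q R
      exact hT.trans ((le_max_left _ _).trans
        (le_iSup₂_of_le T T.to_countable.measurableSet le_rfl))
    · obtain ⟨T, hT⟩ := lintegral_tsub_le_of_le_one (fun b => prob_le_one (μ := κ b) (s := S)) R Q
      exact hT.trans ((le_max_right _ _).trans
        (le_iSup₂_of_le T T.to_countable.measurableSet le_rfl))
  · have hLQ := Kernel.map_comp_measure_eq_self hπ hκ Q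
    have hLR := Kernel.map_comp_measure_eq_self hπ hκ R
    refine le_iSup₂_of_le (π ⁻¹' T) (hπ hT) ?_
    rw [← Measure.map_apply hπ hT, ← Measure.map_apply hπ hT, hLQ, hLR]

end TotalVariation

section LabelProblem

variable {A : Type*} [Countable A] [MeasurableSpace A] [MeasurableSingletonClass A]

lemma prod_mem_couplings {X Y : Type*} [MeasurableSpace X] [MeasurableSpace Y] (μ : Measure X)
    (ν : Measure Y) [IsProbabilityMeasure μ] [IsProbabilityMeasure ν] :
    μ.prod ν ∈ couplings μ ν :=
  ⟨inferInstance, by simp, by simp⟩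

lemma map_diag_mem_couplings {X : Type*} [MeasurableSpace X] (μ : Measure X)
    [IsProbabilityMeasure μ] : μ.map (fun x => (x, x)) ∈ couplings μ μ := by
  have h : Measurable fun x : X => (x, x) := measurable_id'.prodMk measurable_id'
  refine ⟨Measure.isProbabilityMeasure_map h.aemeasurable, ?_, ?_⟩
  · rw [Measure.map_map measurable_fst h]
    exact Measure.map_id
  · rw [Measure.map_map measurable_snd h]
    exact Measure.map_id

lemma map_prodMap_mem_couplings {X X' Y Y' : Type*} [MeasurableSpace X] [MeasurableSpace X']
    [MeasurableSpace Y] [MeasurableSpace Y'] {μ : Measure X} {ν : Measure Y} {f : X → X'}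
    {g : Y → Y'} (hf : Measurable f) (hg : Measurable g) {P : Measure (X × Y)}
    (hP : P ∈ couplings μ ν) : P.map (Prod.map f g) ∈ couplings (μ.map f) (ν.map g) := by
  obtain ⟨h1, h2, h3⟩ := hP
  have hfg : Measurable (Prod.map f g) := hf.prodMap hg
  refine ⟨Measure.isProbabilityMeasure_map hfg.aemeasurable, ?_, ?_⟩
  · rw [Measure.map_map measurable_fst hfg, ← h2, Measure.map_map hf measurable_fst]
    rfl
  · rw [Measure.map_map measurable_snd hfg, ← h3, Measure.map_map hg measurable_snd]
    rfl

lemma ae_eq_of_prod_eq_map_diag {ν : Measure A} [IsProbabilityMeasure ν]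
    (h : ν.prod ν = ν.map fun x => (x, x)) : ∃ a, ∀ᵐ x ∂ν, x = a := by
  have hd : Measurable fun x : A => (x, x) := measurable_id'.prodMk measurable_id'
  obtain ⟨a, ha⟩ : ∃ a, ν {a} ≠ 0 := by
    by_contra! h0
    have : ν univ = 0 := by
      rw [← biUnion_of_singleton (univ : Set A)]
      exact (measure_biUnion_null_iff (to_countable _)).2 fun a _ => h0 a
    simp at this
  refine ⟨a, ae_iff_of_countable.2 fun b hb => ?_⟩
  by_contra hba
  have h1 : (ν.prod ν) {(b, a)} = ν {b} * ν {a} := by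
    rw [← singleton_prod_singleton, Measure.prod_prod]
  have h2 : (fun x : A => (x, x)) ⁻¹' {(b, a)} = ∅ := by
    ext x
    simp only [mem_preimage, mem_singleton_iff, Prod.mk.injEq, mem_empty_iff_false, iff_false,
      not_and]
    rintro rfl
    exact hba
  rw [h, Measure.map_apply hd (measurableSet_singleton _), h2, measure_empty] at h1
  exact mul_ne_zero hb ha h1.symm

/-- If the label problem has at most one minimiser, then its value is finite. -/
lemma entropicCost_ne_top_of_unique {ν : Measure A} [IsProbabilityMeasure ν] {C : A × A → ℝ}
    {ε : ℝ} {P : Measure (A × A)}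
    (hmin : ∀ Q ∈ couplings ν ν, entropicCost C (ν.prod ν) ε P ≤ entropicCost C (ν.prod ν) ε Q)
    (huniq : ∀ Q ∈ couplings ν ν, (∀ R ∈ couplings ν ν,
      entropicCost C (ν.prod ν) ε Q ≤ entropicCost C (ν.prod ν) ε R) → Q = P) :
    entropicCost C (ν.prod ν) ε P ≠ ∞ := by
  intro htop
  have hall : ∀ Q ∈ couplings ν ν, Q = P := fun Q hQ => huniq Q hQ fun R hR => by
    simp [top_le_iff.1 (htop ▸ hmin R hR)]
  have hprod := hall _ (prod_mem_couplings ν ν)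
  have hdiag := hall _ (map_diag_mem_couplings ν)
  obtain ⟨a, ha⟩ := ae_eq_of_prod_eq_map_diag (hprod.trans hdiag.symm)
  rw [← hprod, entropicCost, klDiv_self, mul_zero, add_zero, hprod, ← hdiag,
    lintegral_map (measurable_of_countable _) (measurable_id'.prodMk measurable_id')] at htop
  have hc : ∫⁻ x, ENNReal.ofReal (C (x, x)) ∂ν = ∫⁻ _, ENNReal.ofReal (C (a, a)) ∂ν :=
    lintegral_congr_ae (by filter_upwards [ha] with x hx; rw [hx])
  rw [hc] at htop
  simp at htop

end LabelProblem

section Lift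

variable {X : Type*} [MeasurableSpace X] {A : Type*} [Countable A] [MeasurableSpace A]
  [MeasurableSingletonClass A]

/-- The kernel `(α, β) ↦ λ_α ⊗ λ_β`. -/
def liftKernel (lam : A → Measure X) : Kernel (A × A) (X × X) where
  toFun q := (lam q.1).prod (lam q.2)
  measurable' := measurable_of_countable _

variable {lam : A → Measure X}

instance [∀ α, IsProbabilityMeasure (lam α)] :
    IsMarkovKernel (liftKernel lam) :=
  ⟨fun q => inferInstanceAs (IsProbabilityMeasure ((lam q.1).prod (lam q.2)))⟩

lemma liftPlan_eq_comp_measure (Q : Measure (A × A)) : liftPlan lam Q = liftKernel lam ∘ₘ Q := by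
  ext S hS
  rw [liftPlan, Measure.sum_apply _ hS, Measure.bind_apply hS (Kernel.aemeasurable _),
    lintegral_countable']
  simp [liftKernel, mul_comm]

lemma ae_prodMap_eq_liftKernel [∀ α, SFinite (lam α)] {ℓ : X → A}
    (hℓ : ∀ α, ∀ᵐ x ∂lam α, ℓ x = α) (q : A × A) :
    ∀ᵐ z ∂liftKernel lam q, Prod.map ℓ ℓ z = q := by
  have h1 : ∀ᵐ z ∂(lam q.1).prod (lam q.2), ℓ z.1 = q.1 :=
    Measure.quasiMeasurePreserving_fst.ae (hℓ q.1)
  have h2 : ∀ᵐ z ∂(lam q.1).prod (lam q.2), ℓ z.2 = q.2 :=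
    Measure.quasiMeasurePreserving_snd.ae (hℓ q.2)
  change ∀ᵐ z ∂(lam q.1).prod (lam q.2), Prod.map ℓ ℓ z = q
  filter_upwards [h1, h2] with z hz1 hz2
  exact Prod.ext hz1 hz2

lemma liftPlan_mem_couplings [∀ α, IsProbabilityMeasure (lam α)] {μ : Measure X} {ν : Measure A}
    (hμ : ∀ S, MeasurableSet S → μ S = ∫⁻ α, lam α S ∂ν)
    {Q : Measure (A × A)} (hQ : Q ∈ couplings ν ν) : liftPlan lam Q ∈ couplings μ μ := by
  obtain ⟨hQp, h1, h2⟩ := hQ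
  rw [liftPlan_eq_comp_measure]
  refine ⟨inferInstance, ?_, ?_⟩
  · ext S hS
    rw [Measure.map_apply measurable_fst hS,
      Measure.bind_apply (measurable_fst hS) (Kernel.aemeasurable _), hμ S hS, ← h1,
      lintegral_map (measurable_of_countable _) measurable_fst]
    refine lintegral_congr fun q => ?_
    change ((lam q.1).prod (lam q.2)) (Prod.fst ⁻¹' S) = _
    rw [← prod_univ, Measure.prod_prod, measure_univ, mul_one]
  · ext S hS
    rw [Measure.map_apply measurable_snd hS,
      Measure.bind_apply (measurable_snd hS) (Kernel.aemeasurable _), hμ S hS, ← h2,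
      lintegral_map (measurable_of_countable _) measurable_snd]
    refine lintegral_congr fun q => ?_
    change ((lam q.1).prod (lam q.2)) (Prod.snd ⁻¹' S) = _
    rw [← univ_prod, Measure.prod_prod, measure_univ, one_mul]

lemma liftPlan_prod [∀ α, IsProbabilityMeasure (lam α)] {μ : Measure X} [SigmaFinite μ]
    {ν : Measure A} [IsFiniteMeasure ν]
    (hμ : ∀ S, MeasurableSet S → μ S = ∫⁻ α, lam α S ∂ν) :
    liftPlan lam (ν.prod ν) = μ.prod μ := by
  refine (Measure.prod_eq fun S T hS hT => ?_).symm
  rw [liftPlan_eq_comp_measure, Measure.bind_apply (hS.prod hT) (Kernel.aemeasurable _),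
    hμ S hS, hμ T hT, ← lintegral_prod_mul (measurable_of_countable _).aemeasurable
      (measurable_of_countable _).aemeasurable]
  refine lintegral_congr fun q => ?_
  change ((lam q.1).prod (lam q.2)) (S ×ˢ T) = _
  rw [Measure.prod_prod]

end Lift

/-- **Exact reduction to the label problem** (Proposition 4.5): in the partitioned setting
with conditionally uniform reference measures and block-constant cost, for every `ε > 0`:
(i) the entropic values of the continuous and of the label problem coincide, the minimisers
of `J_ε` are exactly the lifts of minimisers of `Ĵ_ε`, and the unique minimiser of `J_ε`
is `L(P̂_ε)`; (ii) on each rectangle `I_α × I_β` the minimiser restricts to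
`P̂_ε(α,β)(λ_α ⊗ λ_β)`, with the induced mass identities; (iii) the lift is a total
variation isometry. -/
theorem exact_reduction_to_label_problem
    {X : Type*} [MetricSpace X] [PolishSpace X] [MeasurableSpace X] [BorelSpace X]
    {A : Type*} [Countable A] [MeasurableSpace A] [DiscreteMeasurableSpace A]
    (I : A → Set X) (hImeas : ∀ α, MeasurableSet (I α))
    (hIdisj : Pairwise (Function.onFun Disjoint I)) (hIcover : (⋃ α, I α) = univ)
    (lam : A → Measure X) (hlam : ∀ α, IsProbabilityMeasure (lam α))
    (hlamconc : ∀ α, lam α (I α) = 1)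
    (m : A → ℝ≥0∞) (hm : ∑' α, m α = 1)
    (μ : Measure X) (hμ : μ = Measure.sum (fun α => m α • lam α))
    (ℓ : X → A) (hℓmeas : Measurable ℓ) (hℓ : ∀ α, ∀ x ∈ I α, ℓ x = α)
    (Chat : A × A → ℝ) (hChat : ∀ q, 0 ≤ Chat q)
    (Phat : ℝ → Measure (A × A))
    (hPhat : ∀ ε : ℝ, 0 < ε →
      Phat ε ∈ couplings (μ.map ℓ) (μ.map ℓ) ∧
      (∀ Q ∈ couplings (μ.map ℓ) (μ.map ℓ),
        Jfun Chat ((μ.map ℓ).prod (μ.map ℓ)) ε (Phat ε) ≤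
          Jfun Chat ((μ.map ℓ).prod (μ.map ℓ)) ε Q) ∧
      (∀ Q ∈ couplings (μ.map ℓ) (μ.map ℓ),
        (∀ R ∈ couplings (μ.map ℓ) (μ.map ℓ),
          Jfun Chat ((μ.map ℓ).prod (μ.map ℓ)) ε Q ≤
            Jfun Chat ((μ.map ℓ).prod (μ.map ℓ)) ε R) → Q = Phat ε)) :
    ∀ ε : ℝ, 0 < ε →
      -- (i) value identity, argmin identification, unique minimiser `L(P̂_ε)`
      ((⨅ P ∈ couplings μ μ, Jfun (fun p => Chat (ℓ p.1, ℓ p.2)) (μ.prod μ) ε P) =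
        ⨅ Q ∈ couplings (μ.map ℓ) (μ.map ℓ), Jfun Chat ((μ.map ℓ).prod (μ.map ℓ)) ε Q) ∧
      ({P | P ∈ couplings μ μ ∧ ∀ Q ∈ couplings μ μ,
          Jfun (fun p => Chat (ℓ p.1, ℓ p.2)) (μ.prod μ) ε P ≤
            Jfun (fun p => Chat (ℓ p.1, ℓ p.2)) (μ.prod μ) ε Q} =
        liftPlan lam '' {Q | Q ∈ couplings (μ.map ℓ) (μ.map ℓ) ∧
          ∀ R ∈ couplings (μ.map ℓ) (μ.map ℓ),
            Jfun Chat ((μ.map ℓ).prod (μ.map ℓ)) ε Q ≤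
              Jfun Chat ((μ.map ℓ).prod (μ.map ℓ)) ε R}) ∧
      (liftPlan lam (Phat ε) ∈ couplings μ μ) ∧
      (∀ Q ∈ couplings μ μ,
        Jfun (fun p => Chat (ℓ p.1, ℓ p.2)) (μ.prod μ) ε (liftPlan lam (Phat ε)) ≤
          Jfun (fun p => Chat (ℓ p.1, ℓ p.2)) (μ.prod μ) ε Q) ∧
      (∀ Q ∈ couplings μ μ,
        (∀ R ∈ couplings μ μ,
          Jfun (fun p => Chat (ℓ p.1, ℓ p.2)) (μ.prod μ) ε Q ≤
            Jfun (fun p => Chat (ℓ p.1, ℓ p.2)) (μ.prod μ) ε R) →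
        Q = liftPlan lam (Phat ε)) ∧
      -- (ii) rectangle identities
      (∀ α β : A,
        (liftPlan lam (Phat ε)).restrict (I α ×ˢ I β) =
          (Phat ε) {(α, β)} • ((lam α).prod (lam β))) ∧
      (∀ α β : A, liftPlan lam (Phat ε) (I α ×ˢ I β) = (Phat ε) {(α, β)}) ∧
      (∀ Ahat : Set (A × A),
        liftPlan lam (Phat ε) (⋃ q ∈ Ahat, I q.1 ×ˢ I q.2) = (Phat ε) Ahat) ∧
      -- (iii) the lift is a total variation isometry
      (∀ Q ∈ couplings (μ.map ℓ) (μ.map ℓ), ∀ R ∈ couplings (μ.map ℓ) (μ.map ℓ),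
        TVdist (liftPlan lam Q) (liftPlan lam R) = TVdist Q R) := by
  have hpre : ∀ α, I α = ℓ ⁻¹' {α} := fun α => by
    refine Subset.antisymm (hℓ α) fun x hx => ?_
    obtain ⟨β, hβ⟩ := mem_iUnion.1 (hIcover ▸ mem_univ x)
    obtain rfl : β = α := (hℓ β x hβ).symm.trans hx
    exact hβ
  have hℓae : ∀ α, ∀ᵐ x ∂lam α, ℓ x = α := fun α => by
    have h := (prob_compl_eq_zero_iff (hImeas α)).2 (hlamconc α)
    filter_upwards [compl_mem_ae_iff.2 h] with x hx
    exact hℓ α x (not_not.1 hx)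
  have : IsProbabilityMeasure μ := ⟨by simp [hμ, hm]⟩
  have : IsProbabilityMeasure (μ.map ℓ) := Measure.isProbabilityMeasure_map hℓmeas.aemeasurable
  have hmix : ∀ S, MeasurableSet S → μ S = ∫⁻ α, lam α S ∂(μ.map ℓ) := fun S hS => by
    rw [lintegral_map (measurable_of_countable _) hℓmeas]
    conv_rhs => rw [hμ]
    rw [hμ, Measure.sum_apply _ hS, lintegral_sum_measure]
    refine tsum_congr fun α => ?_
    rw [lintegral_smul_measure, Measure.smul_apply]
    congr 1
    have h : ∫⁻ x, lam (ℓ x) S ∂lam α = ∫⁻ _, lam α S ∂lam α :=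
      lintegral_congr_ae (by filter_upwards [hℓae α] with x hx; rw [hx])
    simp [h]
  set ν := μ.map ℓ
  set π : X × X → A × A := Prod.map ℓ ℓ
  have hπ : Measurable π := hℓmeas.prodMap hℓmeas
  have hκ : ∀ q, ∀ᵐ z ∂liftKernel lam q, π z = q := ae_prodMap_eq_liftKernel hℓae
  have hrect : ∀ α β, I α ×ˢ I β = π ⁻¹' {(α, β)} := fun α β => by
    rw [hpre, hpre, ← singleton_prod_singleton]
    rfl
  have hlift : ∀ Q ∈ couplings ν ν, liftPlan lam Q ∈ couplings μ μ :=
    fun Q hQ => liftPlan_mem_couplings hmix hQ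
  have hproj : ∀ P ∈ couplings μ μ, P.map π ∈ couplings ν ν :=
    fun P hP => map_prodMap_mem_couplings hℓmeas hℓmeas hP
  have hπlift : ∀ Q ∈ couplings ν ν, (liftPlan lam Q).map π = Q := fun Q hQ => by
    have := hQ.1
    rw [liftPlan_eq_comp_measure]
    exact Kernel.map_comp_measure_eq_self hπ hκ Q
  intro ε hε
  obtain ⟨hmem, hmin, huniq⟩ := hPhat ε hε
  set J := Jfun (fun p : X × X => Chat (ℓ p.1, ℓ p.2)) (μ.prod μ) ε with hJ
  set Jhat := Jfun Chat (ν.prod ν) ε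
  have hJhatE : ∀ Q ∈ couplings ν ν, Jhat Q = (entropicCost Chat (ν.prod ν) ε Q : EReal) :=
    fun Q hQ => have := hQ.1; Jfun_eq_entropicCost Chat (ν.prod ν) hε Q
  have hJE : ∀ P ∈ couplings μ μ, J P = ((entropicCost Chat (ν.prod ν) ε (P.map π) +
      ENNReal.ofReal ε * klDiv P (liftPlan lam (P.map π)) : ℝ≥0∞) : EReal) := fun P hP => by
    have := hP.1
    rw [hJ, Jfun_eq_entropicCost _ _ hε, ← liftPlan_prod hmix, liftPlan_eq_comp_measure,
      liftPlan_eq_comp_measure, ← Kernel.entropicCost_comp_measure_eq_add hπ hκ]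
    rfl
  have hle : ∀ P ∈ couplings μ μ, Jhat (P.map π) ≤ J P := fun P hP => by
    rw [hJhatE _ (hproj P hP), hJE P hP, EReal.coe_ennreal_le_coe_ennreal_iff]
    exact le_self_add
  have hJlift : ∀ Q ∈ couplings ν ν, J (liftPlan lam Q) = Jhat Q := fun Q hQ => by
    have := (hlift Q hQ).1
    rw [hJE _ (hlift Q hQ), hπlift Q hQ, klDiv_self, mul_zero, add_zero, hJhatE Q hQ]
  have hfin : entropicCost Chat (ν.prod ν) ε (Phat ε) ≠ ∞ := by
    refine entropicCost_ne_top_of_unique (fun Q hQ => ?_) fun Q hQ h => huniq Q hQ fun R hR => ?_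
    · have := hmin Q hQ
      rwa [hJhatE _ hmem, hJhatE Q hQ, EReal.coe_ennreal_le_coe_ennreal_iff] at this
    · rw [hJhatE Q hQ, hJhatE R hR, EReal.coe_ennreal_le_coe_ennreal_iff]
      exact h R hR
  have hLmin : ∀ Q ∈ couplings μ μ, J (liftPlan lam (Phat ε)) ≤ J Q := fun Q hQ =>
    (hJlift _ hmem).trans_le ((hmin _ (hproj Q hQ)).trans (hle Q hQ))
  have hLuniq : ∀ Q ∈ couplings μ μ, (∀ R ∈ couplings μ μ, J Q ≤ J R) →
      Q = liftPlan lam (Phat ε) := fun Q hQ h => by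
    have hQle : J Q ≤ Jhat (Phat ε) := (h _ (hlift _ hmem)).trans_eq (hJlift _ hmem)
    have hQπ : Q.map π = Phat ε := huniq _ (hproj Q hQ) fun R hR =>
      (hle Q hQ).trans (hQle.trans (hmin R hR))
    rw [hJE Q hQ, hJhatE _ hmem, EReal.coe_ennreal_le_coe_ennreal_iff, hQπ] at hQle
    have h0 : ENNReal.ofReal ε * klDiv Q (liftPlan lam (Phat ε)) = 0 := by
      have := ENNReal.le_sub_of_add_le_left hfin hQle
      rwa [tsub_self, nonpos_iff_eq_zero] at this
    have := hQ.1
    have := (hlift _ hmem).1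
    exact klDiv_eq_zero_iff.1 ((mul_eq_zero.1 h0).resolve_left (ENNReal.ofReal_pos.2 hε).ne')
  have := hmem.1
  have hLpre : ∀ T : Set (A × A), liftPlan lam (Phat ε) (π ⁻¹' T) = Phat ε T := fun T => by
    rw [← Measure.map_apply hπ T.to_countable.measurableSet, hπlift _ hmem]
  refine ⟨?_, ?_, hlift _ hmem, hLmin, hLuniq, fun α β => ?_, fun α β => ?_, fun T => ?_,
    fun Q hQ R hR => ?_⟩
  · exact le_antisymm
      (le_iInf₂ fun Q hQ => (iInf₂_le _ (hlift Q hQ)).trans_eq (hJlift Q hQ))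
      (le_iInf₂ fun P hP => (iInf₂_le _ (hproj P hP)).trans (hle P hP))
  · ext P
    constructor
    · rintro ⟨hP, h⟩
      exact ⟨Phat ε, ⟨hmem, hmin⟩, (hLuniq P hP h).symm⟩
    · rintro ⟨Q, ⟨hQ, h⟩, rfl⟩
      rw [huniq Q hQ h]
      exact ⟨hlift _ hmem, hLmin⟩
  · ext S hS
    rw [Measure.restrict_apply hS, hrect, liftPlan_eq_comp_measure,
      Kernel.comp_measure_inter_preimage hπ hκ _ hS (measurableSet_singleton _),
      lintegral_singleton, Measure.smul_apply, smul_eq_mul, mul_comm]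
    rfl
  · rw [hrect, hLpre]
  · rw [← hLpre]
    congr 1
    ext z
    simp [hrect]
  · have := hQ.1
    have := hR.1
    rw [liftPlan_eq_comp_measure, liftPlan_eq_comp_measure]
    exact TVdist_comp_measure hπ hκ Q R

end
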